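/- Let (W,S) be a Coxeter system and let A, B ⊆ S be finitary subsets, with longest elements w_A of W_A and w_B of W_B. For w ∈ W, the following conditions are equivalent: (1) w is minimal in wW_B and, for every v ∈ W_B, wv is minimal in W_A(wv); (2) w is minimal in wW_B and w·w_B is minimal in W_A(w w_B); (3) w is minimal in W_A w and, for every v ∈ W_A, vw is minimal in (vw)W_B; (4) w is minimal in W_A w and w_A w is minimal in (w_A w)W_B; (5) ℓ(w_A w w_B) = ℓ(w_A) + ℓ(w) + ℓ(w_B). -/

import Mathlib

/-- For `J` a subset of the simple reflections, `W_J` is the subgroup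
(standard parabolic subgroup) generated by the simple reflections in `J`. -/
def CoxeterSystem.parabolic {ι W : Type*} [Group W] {M : CoxeterMatrix ι}
    (cs : CoxeterSystem M W) (J : Set ι) : Subgroup W :=
  Subgroup.closure (cs.simple '' J)

/-- `w` is minimal in the coset `w W_J`, i.e. `ℓ(wu) = ℓ(w) + ℓ(u)` for all
`u ∈ W_J`. -/
def CoxeterSystem.IsMinimalInRightCoset {ι W : Type*} [Group W] {M : CoxeterMatrix ι}
    (cs : CoxeterSystem M W) (J : Set ι) (w : W) : Prop :=
  ∀ u ∈ cs.parabolic J, cs.length (w * u) = cs.length w + cs.length u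

/-- `w` is minimal in the coset `W_J w`, i.e. `ℓ(uw) = ℓ(u) + ℓ(w)` for all
`u ∈ W_J`. -/
def CoxeterSystem.IsMinimalInLeftCoset {ι W : Type*} [Group W] {M : CoxeterMatrix ι}
    (cs : CoxeterSystem M W) (J : Set ι) (w : W) : Prop :=
  ∀ u ∈ cs.parabolic J, cs.length (u * w) = cs.length u + cs.length w

namespace CoxeterSystem

variable {ι W : Type*} [Group W] {M : CoxeterMatrix ι} (cs : CoxeterSystem M W)

/-! ### The exchange condition -/

open scoped Classical in
/-- The simple reflection `s i` acts on `W × ZMod 2` by `(t, e) ↦ (s i * t * s i, e + [t = s i])`. -/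
noncomputable def signedConj (i : ι) : Equiv.Perm (W × ZMod 2) :=
  Function.Involutive.toPerm
    (fun x ↦ (cs.simple i * x.1 * cs.simple i, x.2 + if x.1 = cs.simple i then 1 else 0)) <| by
    rintro ⟨t, e⟩
    have h : cs.simple i * t * cs.simple i = cs.simple i ↔ t = cs.simple i := by
      constructor
      · intro h
        simpa [mul_assoc] using congrArg (fun x ↦ cs.simple i * x * cs.simple i) h
      · rintro rfl
        simp
    ext
    · simp [mul_assoc]
    · by_cases ht : t = cs.simple i
      · simp [ht, add_assoc, CharTwo.add_self_eq_zero]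
      · simp [h, ht]

open scoped Classical in
theorem signedConj_apply (i : ι) (t : W) (e : ZMod 2) :
    cs.signedConj i (t, e) =
      (cs.simple i * t * cs.simple i, e + if t = cs.simple i then 1 else 0) := rfl

open scoped Classical in
theorem prod_map_signedConj_apply (ω : List ι) (t : W) (e : ZMod 2) :
    (ω.map cs.signedConj).prod (t, e) =
      (cs.wordProd ω * t * (cs.wordProd ω)⁻¹, e + ((cs.rightInvSeq ω).count t : ZMod 2)) := by
  induction ω with
  | nil => simp
  | cons i ω ih =>
    have h : cs.wordProd ω * t * (cs.wordProd ω)⁻¹ = cs.simple i ↔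
        (cs.wordProd ω)⁻¹ * cs.simple i * cs.wordProd ω = t := by
      constructor
      · intro h
        rw [← h]
        group
      · rintro rfl
        group
    rw [List.map_cons, List.prod_cons, Equiv.Perm.mul_apply, ih, signedConj_apply, rightInvSeq,
      List.count_cons]
    simp only [h, beq_iff_eq]
    ext
    · simp [wordProd_cons, mul_assoc]
    · push_cast
      simp only [add_assoc]

theorem prod_map_reverse_alternatingWord {G : Type*} [Monoid G] (f : ι → G) (i j : ι) (m : ℕ) :
    ((alternatingWord i j (2 * m)).reverse.map f).prod = (f j * f i) ^ m := by
  induction m with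
  | zero => simp [alternatingWord]
  | succ m ih =>
    rw [show 2 * (m + 1) = 2 * m + 1 + 1 by ring, alternatingWord_succ, alternatingWord_succ]
    simp only [List.concat_eq_append, List.reverse_append, List.reverse_singleton,
      List.singleton_append, List.map_cons, List.prod_cons, ih, pow_succ', mul_assoc]

/-- The left inversion sequence of a braid relator is a list repeated twice. -/
theorem exists_leftInvSeq_alternatingWord_eq_append_self (i j : ι) :
    ∃ L : List W, cs.leftInvSeq (alternatingWord i j (2 * M i j)) = L ++ L := by
  refine ⟨(cs.leftInvSeq (alternatingWord i j (2 * M i j))).take (M i j), ?_⟩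
  conv_lhs => rw [← List.take_append_drop (M i j)
    (cs.leftInvSeq (alternatingWord i j (2 * M i j)))]
  congr 1
  apply List.ext_getElem
  · simp
    lia
  intro k h₁ h₂
  simp only [List.length_drop, length_leftInvSeq, length_alternatingWord] at h₁
  rw [List.getElem_drop, List.getElem_take,
    cs.getElem_leftInvSeq_alternatingWord i j (M i j) (M i j + k) (by lia),
    cs.getElem_leftInvSeq_alternatingWord i j (M i j) k (by lia)]
  rw [prod_alternatingWord_eq_mul_pow, prod_alternatingWord_eq_mul_pow,
    show (2 * (M i j + k) + 1) / 2 = M i j + k by lia, show (2 * k + 1) / 2 = k by lia,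
    pow_add, cs.simple_mul_simple_pow', one_mul]
  simp [parity_simps]

theorem isLiftable_signedConj : M.IsLiftable cs.signedConj := by
  classical
  intro i j
  obtain ⟨L, hL⟩ := cs.exists_leftInvSeq_alternatingWord_eq_append_self j i
  rw [M.symmetric i j, ← prod_map_reverse_alternatingWord]
  ext1 ⟨t, e⟩
  have hπ : cs.wordProd (alternatingWord j i (2 * M j i)) = 1 := by
    simp [prod_alternatingWord_eq_mul_pow]
  rw [prod_map_signedConj_apply, rightInvSeq_reverse, wordProd_reverse, hπ, hL, List.count_reverse,
    List.count_append]
  simp [CharTwo.add_self_eq_zero]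

open scoped Classical in
theorem count_rightInvSeq_eq_of_wordProd_eq {ω ω' : List ι}
    (h : cs.wordProd ω = cs.wordProd ω') (t : W) :
    ((cs.rightInvSeq ω).count t : ZMod 2) = (cs.rightInvSeq ω').count t := by
  have key (α : List ι) : cs.lift ⟨_, cs.isLiftable_signedConj⟩ (cs.wordProd α) =
      (α.map cs.signedConj).prod := by
    rw [wordProd, map_list_prod, List.map_map]
    congr 2
    ext1 i
    exact cs.lift_apply_simple cs.isLiftable_signedConj i
  have := congrArg Prod.snd (Equiv.congr_fun ((key ω).symm.trans (h ▸ key ω')) (t, 0))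
  simpa only [prod_map_signedConj_apply, zero_add] using this

/-- The exchange condition. -/
theorem exists_wordProd_mul_simple_eq_eraseIdx {ω : List ι} {i : ι}
    (h : cs.IsRightDescent (cs.wordProd ω) i) :
    ∃ k < ω.length, cs.wordProd ω * cs.simple i = cs.wordProd (ω.eraseIdx k) := by
  classical
  obtain ⟨α, hα, hαω⟩ := cs.exists_isReduced (cs.wordProd ω * cs.simple i)
  have hprod : cs.wordProd (α.concat i) = cs.wordProd ω := by
    rw [wordProd_concat, ← hαω, simple_mul_simple_cancel_right]
  have hred : cs.IsReduced (α.concat i) := by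
    have h₁ := cs.isRightDescent_iff.mp h
    rw [hαω, hα.eq] at h₁
    rw [IsReduced, hprod, List.length_concat, h₁]
  have hmem : cs.simple i ∈ cs.rightInvSeq (α.concat i) := by
    rw [rightInvSeq_concat]
    simp
  have hcount := cs.count_rightInvSeq_eq_of_wordProd_eq hprod (cs.simple i)
  rw [List.count_eq_one_of_mem hred.nodup_rightInvSeq hmem] at hcount
  have hmem' : cs.simple i ∈ cs.rightInvSeq ω := by
    by_contra hn
    simp [List.count_eq_zero_of_not_mem hn] at hcount
  obtain ⟨k, hk, hki⟩ := List.mem_iff_getElem.mp hmem'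
  refine ⟨k, by simpa using hk, ?_⟩
  rw [← wordProd_mul_getD_rightInvSeq, List.getD_eq_getElem _ _ hk, hki]

/-! ### Longest elements of parabolic subgroups -/

theorem exists_isReduced_of_mem_parabolic {J : Set ι} {u : W} (hu : u ∈ cs.parabolic J) :
    ∃ ω : List ι, cs.IsReduced ω ∧ (∀ i ∈ ω, i ∈ J) ∧ cs.wordProd ω = u := by
  have step {u : W} {i : ι} (hi : i ∈ J)
      (h : ∃ ω : List ι, cs.IsReduced ω ∧ (∀ i ∈ ω, i ∈ J) ∧ cs.wordProd ω = u) :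
      ∃ ω : List ι, cs.IsReduced ω ∧ (∀ i ∈ ω, i ∈ J) ∧ cs.wordProd ω = u * cs.simple i := by
    obtain ⟨ω, hω, hJ, rfl⟩ := h
    by_cases hd : cs.IsRightDescent (cs.wordProd ω) i
    · obtain ⟨k, hk, hk'⟩ := cs.exists_wordProd_mul_simple_eq_eraseIdx hd
      refine ⟨ω.eraseIdx k, ?_, fun a ha ↦ hJ a (List.mem_of_mem_eraseIdx ha), hk'.symm⟩
      have := cs.isRightDescent_iff.mp hd
      rw [hω.eq] at this
      rw [IsReduced, ← hk', List.length_eraseIdx_of_lt hk]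
      lia
    · refine ⟨ω.concat i, ?_, ?_, cs.wordProd_concat i ω⟩
      · rw [IsReduced, wordProd_concat, cs.not_isRightDescent_iff.mp hd, hω.eq, List.length_concat]
      · intro a ha
        rw [List.concat_eq_append, List.mem_append, List.mem_singleton] at ha
        rcases ha with ha | rfl
        exacts [hJ a ha, hi]
  induction hu using Subgroup.closure_induction_right with
  | one => exact ⟨[], by simp [IsReduced], by simp, by simp⟩
  | mul_right x _ y hy ih =>
    obtain ⟨i, hi, rfl⟩ := hy
    exact step hi ih
  | mul_inv_cancel x _ y hy ih =>
    obtain ⟨i, hi, rfl⟩ := hy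
    rw [inv_simple]
    exact step hi ih

theorem simple_mem_parabolic {J : Set ι} {i : ι} (hi : i ∈ J) : cs.simple i ∈ cs.parabolic J :=
  Subgroup.subset_closure ⟨i, hi, rfl⟩

theorem length_mul_inv_add_length_of_isReduced {J : Set ι} {x : W}
    (hx : ∀ i ∈ J, cs.IsRightDescent x i) {ω : List ι} (hω : cs.IsReduced ω)
    (hJ : ∀ i ∈ ω, i ∈ J) :
    cs.length (x * (cs.wordProd ω)⁻¹) + ω.length = cs.length x := by
  induction ω using List.reverseRecOn with
  | nil => simp
  | append_singleton ω i ih =>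
    have hω' : cs.IsReduced ω := by simpa using hω.take ω.length
    replace ih := ih hω' fun a ha ↦ hJ a (by simp [ha])
    obtain ⟨α, hα, hαx⟩ := cs.exists_isReduced (x * (cs.wordProd ω)⁻¹)
    have hprod : cs.wordProd (α ++ ω) = x := by
      rw [wordProd_append, ← hαx, inv_mul_cancel_right]
    have hd : cs.IsRightDescent (cs.wordProd (α ++ ω)) i := hprod ▸ hx i (hJ i (by simp))
    obtain ⟨k, hk, hk'⟩ := cs.exists_wordProd_mul_simple_eq_eraseIdx hd
    rw [hαx, hα.eq] at ih
    by_cases hkα : k < α.length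
    · rw [List.eraseIdx_append_of_lt_length hkα, hprod, wordProd_append] at hk'
      have heq : x * (cs.wordProd (ω ++ [i]))⁻¹ = cs.wordProd (α.eraseIdx k) := by
        rw [wordProd_append, wordProd_singleton, mul_inv_rev, inv_simple, ← mul_assoc, hk',
          mul_inv_cancel_right]
      have h₁ := cs.length_wordProd_le (α.eraseIdx k)
      rw [← heq, List.length_eraseIdx_of_lt hkα] at h₁
      have h₂ := cs.length_mul_le (x * (cs.wordProd (ω ++ [i]))⁻¹) (cs.wordProd (ω ++ [i]))
      rw [inv_mul_cancel_right, hω.eq] at h₂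
      rw [List.length_append, List.length_singleton] at h₂ ⊢
      lia
    · exfalso
      rw [List.length_append] at hk
      rw [List.eraseIdx_append_of_length_le (not_lt.mp hkα), wordProd_append, wordProd_append,
        mul_assoc, mul_right_inj] at hk'
      have h₁ := hω.eq
      rw [wordProd_append, wordProd_singleton, hk', List.length_append] at h₁
      have h₂ := cs.length_wordProd_le (ω.eraseIdx (k - α.length))
      rw [List.length_eraseIdx_of_lt (by lia)] at h₂
      lia

theorem length_longest_mul_inv_add_length {J : Set ι} {x : W} (hx : x ∈ cs.parabolic J)
    (hmax : ∀ u ∈ cs.parabolic J, cs.length u ≤ cs.length x) {u : W} (hu : u ∈ cs.parabolic J) :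
    cs.length (x * u⁻¹) + cs.length u = cs.length x := by
  obtain ⟨ω, hω, hJ, rfl⟩ := cs.exists_isReduced_of_mem_parabolic hu
  rw [hω.eq]
  exact cs.length_mul_inv_add_length_of_isReduced
    (fun i hi ↦ lt_of_le_of_ne (hmax _ (mul_mem hx (cs.simple_mem_parabolic hi)))
      (cs.length_mul_simple_ne x i)) hω hJ

theorem length_add_length_inv_mul_longest {J : Set ι} {x : W} (hx : x ∈ cs.parabolic J)
    (hmax : ∀ u ∈ cs.parabolic J, cs.length u ≤ cs.length x) {u : W} (hu : u ∈ cs.parabolic J) :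
    cs.length u + cs.length (u⁻¹ * x) = cs.length x := by
  have h := cs.length_longest_mul_inv_add_length (inv_mem hx)
    (fun v hv ↦ (hmax v hv).trans_eq (cs.length_inv x).symm) (inv_mem hu)
  rw [← mul_inv_rev, length_inv, length_inv, length_inv] at h
  lia

/-- If lengths add up in `wA * w * wB`, with `wA`, `wB` longest elements of parabolic subgroups,
then they add up in `u * w * v` for all `u`, `v` in these subgroups. -/
theorem length_mul_mul_of_longest {A B : Set ι} {wA wB w : W} (hwA : wA ∈ cs.parabolic A)
    (hwAmax : ∀ u ∈ cs.parabolic A, cs.length u ≤ cs.length wA)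
    (hwB : wB ∈ cs.parabolic B) (hwBmax : ∀ u ∈ cs.parabolic B, cs.length u ≤ cs.length wB)
    (h : cs.length (wA * w * wB) = cs.length wA + cs.length w + cs.length wB)
    {u v : W} (hu : u ∈ cs.parabolic A) (hv : v ∈ cs.parabolic B) :
    cs.length (u * w * v) = cs.length u + cs.length w + cs.length v := by
  have hA := cs.length_longest_mul_inv_add_length hwA hwAmax hu
  have hB := cs.length_add_length_inv_mul_longest hwB hwBmax hv
  have heq : wA * w * wB = wA * u⁻¹ * (u * w * v) * (v⁻¹ * wB) := by group
  have h₁ := cs.length_mul_le (wA * u⁻¹ * (u * w * v)) (v⁻¹ * wB)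
  have h₂ := cs.length_mul_le (wA * u⁻¹) (u * w * v)
  have h₃ := cs.length_mul_le (u * w) v
  have h₄ := cs.length_mul_le u w
  rw [← heq] at h₁
  lia

end CoxeterSystem

/-- Let `A`, `B` be finitary subsets of the simple reflections, with longest
elements `w_A ∈ W_A` and `w_B ∈ W_B`.  For `w ∈ W` the following are equivalent:
(1) `w` is minimal in `w W_B` and `wv` is minimal in `W_A (wv)` for every `v ∈ W_B`;
(2) `w` is minimal in `w W_B` and `w w_B` is minimal in `W_A (w w_B)`;
(3) `w` is minimal in `W_A w` and `vw` is minimal in `(vw) W_B` for every `v ∈ W_A`;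
(4) `w` is minimal in `W_A w` and `w_A w` is minimal in `(w_A w) W_B`;
(5) `ℓ(w_A w w_B) = ℓ(w_A) + ℓ(w) + ℓ(w_B)`. -/
theorem CoxeterSystem.doubleCoset_minimal_tfae {ι W : Type*} [Group W]
    {M : CoxeterMatrix ι} (cs : CoxeterSystem M W) (A B : Set ι)
    (hAfin : (cs.parabolic A : Set W).Finite)
    (hBfin : (cs.parabolic B : Set W).Finite)
    (wA : W) (hwA : wA ∈ cs.parabolic A)
    (hwAmax : ∀ u ∈ cs.parabolic A, cs.length u ≤ cs.length wA)
    (wB : W) (hwB : wB ∈ cs.parabolic B)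
    (hwBmax : ∀ u ∈ cs.parabolic B, cs.length u ≤ cs.length wB)
    (w : W) :
    [cs.IsMinimalInRightCoset B w ∧
        ∀ v ∈ cs.parabolic B, cs.IsMinimalInLeftCoset A (w * v),
      cs.IsMinimalInRightCoset B w ∧ cs.IsMinimalInLeftCoset A (w * wB),
      cs.IsMinimalInLeftCoset A w ∧
        ∀ v ∈ cs.parabolic A, cs.IsMinimalInRightCoset B (v * w),
      cs.IsMinimalInLeftCoset A w ∧ cs.IsMinimalInRightCoset B (wA * w),
      cs.length (wA * w * wB) = cs.length wA + cs.length w + cs.length wB].TFAE := by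
  have key (h : cs.length (wA * w * wB) = cs.length wA + cs.length w + cs.length wB) (u v : W)
      (hu : u ∈ cs.parabolic A) (hv : v ∈ cs.parabolic B) :
      cs.length (u * w * v) = cs.length u + cs.length w + cs.length v :=
    cs.length_mul_mul_of_longest hwA hwAmax hwB hwBmax h hu hv
  have keyB (h : cs.length (wA * w * wB) = cs.length wA + cs.length w + cs.length wB) :
      cs.IsMinimalInRightCoset B w := fun v hv ↦ by
    simpa using key h 1 v (one_mem _) hv
  have keyA (h : cs.length (wA * w * wB) = cs.length wA + cs.length w + cs.length wB) :
      cs.IsMinimalInLeftCoset A w := fun u hu ↦ by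
    simpa using key h u 1 hu (one_mem _)
  tfae_have 1 → 2 := fun ⟨h₁, h₂⟩ ↦ ⟨h₁, h₂ wB hwB⟩
  tfae_have 2 → 5 := fun ⟨h₁, h₂⟩ ↦ by rw [mul_assoc, h₂ wA hwA, h₁ wB hwB, add_assoc]
  tfae_have 5 → 1 := fun h ↦ ⟨keyB h, fun v hv u hu ↦ by
    rw [← mul_assoc, key h u v hu hv, keyB h v hv, add_assoc]⟩
  tfae_have 3 → 4 := fun ⟨h₁, h₂⟩ ↦ ⟨h₁, h₂ wA hwA⟩
  tfae_have 4 → 5 := fun ⟨h₁, h₂⟩ ↦ by rw [h₂ wB hwB, h₁ wA hwA]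
  tfae_have 5 → 3 := fun h ↦ ⟨keyA h, fun u hu v hv ↦ by
    rw [key h u v hu hv, keyA h u hu]⟩
  tfae_finish
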